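/- arXiv:2407.03213 — 4 statements merged into one kernel-verified Lean document; each statement's English description precedes it below -/
import Mathlib

section
/- Singular-arc identity (the equation W u + d = 0 on singular arcs): Let f_0, f_1, …, f_m : ℝ^n → ℝ^n be twice continuously differentiable, u : I → ℝ^m continuous on an open interval I, and x, p : I → ℝ^n differentiable with x'(t) = f_0(x(t)) + Σ_{j=1}^m u_j(t) f_j(x(t)) and p'(t) = −(Df_0(x(t)) + Σ_{j=1}^m u_j(t) Df_j(x(t)))ᵀ p(t) for all t ∈ I. Assume the stationarity conditions p(t)ᵀ f_i(x(t)) = 0 for all t ∈ I and all i ∈ {1,…,m}, and the Goh conditions p(t)ᵀ [f_j, f_i](x(t)) = 0 for all t ∈ I and all i, j ∈ {1,…,m}. Then for all t ∈ I and all i ∈ {1,…,m}: p(t)ᵀ [f_0, [f_0, f_i]](x(t)) + Σ_{j=1}^m u_j(t) p(t)ᵀ [f_j, [f_0, f_i]](x(t)) = 0. -/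
open Matrix

/-- The Lie bracket of two vector fields: `[h,k](x) = Dk(x) h(x) - Dh(x) k(x)`. -/
noncomputable def lieBracket {E : Type*} [NormedAddCommGroup E] [NormedSpace ℝ E]
    (h k : E → E) : E → E :=
  fun x => fderiv ℝ k x (h x) - fderiv ℝ h x (k x)

theorem ContDiff.lieBracket {E : Type*} [NormedAddCommGroup E] [NormedSpace ℝ E]
    {h k : E → E} {r s : WithTop ℕ∞} (hh : ContDiff ℝ s h) (hk : ContDiff ℝ s k)
    (hrs : r + 1 ≤ s) : ContDiff ℝ r (lieBracket h k) :=
  ContDiff.lieBracket_vectorField (𝕜 := ℝ) hh hk hrs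

theorem HasDerivAt.dotProduct {ι : Type*} [Fintype ι] {p y : ℝ → ι → ℝ} {p' y' : ι → ℝ} {t : ℝ}
    (hp : HasDerivAt p p' t) (hy : HasDerivAt y y' t) :
    HasDerivAt (fun s => p s ⬝ᵥ y s) (p' ⬝ᵥ y t + p t ⬝ᵥ y') t := by
  rw [hasDerivAt_pi] at hp hy
  refine (HasDerivAt.fun_sum fun i (_ : i ∈ Finset.univ) => (hp i).fun_mul (hy i)).congr_deriv ?_
  simp only [_root_.dotProduct, Finset.sum_add_distrib]

/-- Along a solution of a control-affine system and of its adjoint equation, the derivative of the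
pairing of the adjoint state with a vector field `g` is the pairing with the brackets of `g`. -/
theorem hasDerivAt_dotProduct_comp_of_adjoint {ι κ : Type*} [Fintype ι] [Fintype κ]
    {f0 : (ι → ℝ) → ι → ℝ} {f : κ → (ι → ℝ) → ι → ℝ} {g : (ι → ℝ) → ι → ℝ}
    {w : κ → ℝ} {x p : ℝ → ι → ℝ} {p' : ι → ℝ} {t : ℝ}
    (hx : HasDerivAt x (f0 (x t) + ∑ j, w j • f j (x t)) t) (hp : HasDerivAt p p' t)
    (hadj : ∀ v : ι → ℝ,
      p' ⬝ᵥ v = -(p t ⬝ᵥ (fderiv ℝ f0 (x t) v + ∑ j, w j • fderiv ℝ (f j) (x t) v)))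
    (hg : DifferentiableAt ℝ g (x t)) :
    HasDerivAt (fun s => p s ⬝ᵥ g (x s))
      (p t ⬝ᵥ lieBracket f0 g (x t) + ∑ j, w j * (p t ⬝ᵥ lieBracket (f j) g (x t))) t := by
  have h := hp.dotProduct (hg.hasFDerivAt.comp_hasDerivAt t hx)
  refine h.congr_deriv ?_
  simp only [Function.comp_apply, hadj, lieBracket, map_add, map_sum, map_smul, dotProduct_add,
    dotProduct_sub, dotProduct_sum, dotProduct_smul, smul_eq_mul, mul_sub,
    Finset.sum_sub_distrib]
  ring

theorem HasDerivAt.eq_zero_of_eqOn_zero {F : Type*} [NormedAddCommGroup F] [NormedSpace ℝ F]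
    {φ : ℝ → F} {φ' : F} {s : Set ℝ} {t : ℝ} (h : HasDerivAt φ φ' t) (hs : IsOpen s) (ht : t ∈ s)
    (hφ : ∀ r ∈ s, φ r = 0) : φ' = 0 :=
  h.unique <| (hasDerivAt_const t (0 : F)).congr_of_eventuallyEq <|
    Filter.eventually_of_mem (hs.mem_nhds ht) hφ

/-- Singular-arc identity `W u + d = 0` on singular arcs. -/
theorem singular_arc_identity
    (n m : ℕ)
    (f0 : (Fin n → ℝ) → (Fin n → ℝ)) (f : Fin m → (Fin n → ℝ) → (Fin n → ℝ))
    (hf0 : ContDiff ℝ 2 f0) (hf : ∀ i, ContDiff ℝ 2 (f i))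
    (a b : ℝ)
    (u : ℝ → Fin m → ℝ) (hu : ContinuousOn u (Set.Ioo a b))
    (x p p' : ℝ → Fin n → ℝ)
    (hx : ∀ t ∈ Set.Ioo a b,
      HasDerivAt x (f0 (x t) + ∑ j, u t j • f j (x t)) t)
    (hp : ∀ t ∈ Set.Ioo a b, HasDerivAt p (p' t) t)
    (hadj : ∀ t ∈ Set.Ioo a b, ∀ v : Fin n → ℝ,
      p' t ⬝ᵥ v
        = -(p t ⬝ᵥ (fderiv ℝ f0 (x t) v + ∑ j, u t j • fderiv ℝ (f j) (x t) v)))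
    (hstat : ∀ t ∈ Set.Ioo a b, ∀ i : Fin m, p t ⬝ᵥ f i (x t) = 0)
    (hGoh : ∀ t ∈ Set.Ioo a b, ∀ i j : Fin m,
      p t ⬝ᵥ lieBracket (f j) (f i) (x t) = 0) :
    ∀ t ∈ Set.Ioo a b, ∀ i : Fin m,
      p t ⬝ᵥ lieBracket f0 (lieBracket f0 (f i)) (x t)
        + ∑ j, u t j * (p t ⬝ᵥ lieBracket (f j) (lieBracket f0 (f i)) (x t)) = 0 := by
  intro t ht i
  have hbracket : ∀ s ∈ Set.Ioo a b, p s ⬝ᵥ lieBracket f0 (f i) (x s) = 0 := by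
    intro s hs
    have h := (hasDerivAt_dotProduct_comp_of_adjoint (hx s hs) (hp s hs) (hadj s hs)
      ((hf i).differentiable (by norm_num) (x s))).eq_zero_of_eqOn_zero isOpen_Ioo hs
      fun r hr => hstat r hr i
    simpa [hGoh s hs i] using h
  have hdiff : Differentiable ℝ (lieBracket f0 (f i)) :=
    (hf0.lieBracket (r := 1) (hf i) (by norm_num [one_add_one_eq_two])).differentiable (by norm_num)
  exact (hasDerivAt_dotProduct_comp_of_adjoint (hx t ht) (hp t ht) (hadj t ht)
    (hdiff (x t))).eq_zero_of_eqOn_zero isOpen_Ioo ht hbracket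
end

section
/- Lie brackets of the control fields of the linear port-Hamiltonian optimal control problem: Define, for i = 1, …, m, the vector fields f_i : ℝ^n × ℝ → ℝ^n × ℝ by f_i(x,z) = (g_i, xᵀ Q G n_i + ℓ_i). Then for all i, j ∈ {1,…,m} and all (x,z) ∈ ℝ^n × ℝ, [f_i, f_j](x,z) = (0, n_jᵀ Gᵀ Q g_i − n_iᵀ Gᵀ Q g_j). Consequently, all these brackets vanish identically if and only if the matrix Nᵀ Gᵀ Q G is symmetric. -/
open Matrix

/-- The derivative of a field with constant first component and affine second component. -/
theorem fderiv_const_prodMk_dotProduct_add {ι F : Type*} [Fintype ι] [NormedAddCommGroup F]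
    [NormedSpace ℝ F] (c : F) (v : ι → ℝ) (b : ℝ) (w u : (ι → ℝ) × ℝ) :
    fderiv ℝ (fun w : (ι → ℝ) × ℝ => (c, w.1 ⬝ᵥ v + b)) w u = (0, u.1 ⬝ᵥ v) := by
  have h : HasFDerivAt (fun w : (ι → ℝ) × ℝ => w.1 ⬝ᵥ v + b)
      (∑ i, v i • (ContinuousLinearMap.proj (R := ℝ) (φ := fun _ : ι => ℝ) i).comp
        (ContinuousLinearMap.fst ℝ (ι → ℝ) ℝ)) w := by
    refine HasFDerivAt.add_const b (HasFDerivAt.fun_sum fun i _ => HasFDerivAt.mul_const ?_ (v i))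
    exact ((ContinuousLinearMap.proj (R := ℝ) (φ := fun _ : ι => ℝ) i).comp
      (ContinuousLinearMap.fst ℝ (ι → ℝ) ℝ)).hasFDerivAt
  rw [((hasFDerivAt_const c w).prodMk h).fderiv]
  simp [dotProduct, mul_comm]

theorem dotProduct_mulVec_eq_dotProduct_transpose_mulVec {ι κ R : Type*} [Fintype ι] [Fintype κ]
    [CommSemiring R] (A : Matrix ι κ R) (v : ι → R) (w : κ → R) :
    v ⬝ᵥ A *ᵥ w = w ⬝ᵥ Aᵀ *ᵥ v := by
  rw [dotProduct_mulVec, ← mulVec_transpose, dotProduct_comm]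

/-- Lie brackets of the control fields of the linear port-Hamiltonian
optimal control problem, and the symmetry characterization of their vanishing. -/
theorem linear_pH_control_field_brackets
    (n m : ℕ)
    (Q : Matrix (Fin n) (Fin n) ℝ) (hQsym : Qᵀ = Q)
    (G : Matrix (Fin n) (Fin m) ℝ) (N : Matrix (Fin m) (Fin m) ℝ)
    (g : Fin m → Fin n → ℝ) (hg : ∀ i, g i = fun r => G r i)
    (nv : Fin m → Fin m → ℝ) (hnv : ∀ i, nv i = fun r => N r i)
    (l : Fin m → ℝ)
    (f : Fin m → ((Fin n → ℝ) × ℝ) → ((Fin n → ℝ) × ℝ))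
    (hf : ∀ i, f i = fun w => (g i, w.1 ⬝ᵥ (Q * G).mulVec (nv i) + l i)) :
    (∀ i j : Fin m, ∀ w : (Fin n → ℝ) × ℝ,
      lieBracket (f i) (f j) w
        = (0, nv j ⬝ᵥ (Gᵀ * Q).mulVec (g i) - nv i ⬝ᵥ (Gᵀ * Q).mulVec (g j)))
    ∧ ((∀ i j : Fin m, ∀ w : (Fin n → ℝ) × ℝ, lieBracket (f i) (f j) w = 0)
        ↔ (Nᵀ * Gᵀ * Q * G).IsSymm) := by
  have hbr : ∀ i j : Fin m, ∀ w : (Fin n → ℝ) × ℝ, lieBracket (f i) (f j) w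
      = (0, nv j ⬝ᵥ (Gᵀ * Q).mulVec (g i) - nv i ⬝ᵥ (Gᵀ * Q).mulVec (g j)) := by
    intro i j w
    simp only [lieBracket, hf, fderiv_const_prodMk_dotProduct_add, Prod.mk_sub_mk, sub_zero]
    simp only [dotProduct_mulVec_eq_dotProduct_transpose_mulVec (Q * G), transpose_mul, hQsym]
  have hentry : ∀ i j : Fin m,
      nv j ⬝ᵥ (Gᵀ * Q).mulVec (g i) = (Nᵀ * Gᵀ * Q * G) j i := by
    intro i j
    rw [hg, hnv, Matrix.mul_assoc Nᵀ, Matrix.mul_assoc Nᵀ, Matrix.mul_apply]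
    rfl
  refine ⟨hbr, ?_⟩
  simp only [hbr, hentry, Prod.mk_eq_zero, true_and, sub_eq_zero, forall_const]
  exact ⟨fun h => Matrix.IsSymm.ext h, fun h i j => h.apply i j⟩
end

section
/- Double bracket with two control fields for the linear port-Hamiltonian problem: Define f_0 : ℝ^n × ℝ → ℝ^n × ℝ by f_0(x,z) = (A x, xᵀ Q G Y Gᵀ Q x) and, for i ∈ {1,…,m}, f_i(x,z) = (g_i, xᵀ Q G n_i + ℓ_i). Then for all i, j ∈ {1,…,m} and all (x,z) ∈ ℝ^n × ℝ, [f_j, [f_0, f_i]](x,z) = ( 0 , n_iᵀ Gᵀ Q A g_j − 2 g_iᵀ Q G Y Gᵀ Q g_j + n_jᵀ Gᵀ Q A g_i ). -/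
open Matrix

/-- The product rule for the dot product of two vector-valued functions. -/
lemma HasFDerivAt.dotProduct_real {E ι : Type*} [NormedAddCommGroup E] [NormedSpace ℝ E]
    [Fintype ι] {u v : E → ι → ℝ} {u' v' : E →L[ℝ] ι → ℝ} {x : E}
    (hu : HasFDerivAt u u' x) (hv : HasFDerivAt v v' x) :
    HasFDerivAt (fun y => u y ⬝ᵥ v y)
      (∑ i, (u x i • (ContinuousLinearMap.proj i).comp v' +
        v x i • (ContinuousLinearMap.proj i).comp u')) x :=
  HasFDerivAt.fun_sum fun i _ => (hasFDerivAt_pi'.1 hu i).mul (hasFDerivAt_pi'.1 hv i)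

lemma fderiv_linear_quadratic_apply {ι : Type*} [Fintype ι] (A M : Matrix ι ι ℝ)
    (w v : (ι → ℝ) × ℝ) :
    fderiv ℝ (fun w : (ι → ℝ) × ℝ => (A.mulVec w.1, w.1 ⬝ᵥ M.mulVec w.1)) w v
      = (A.mulVec v.1, v.1 ⬝ᵥ M.mulVec w.1 + w.1 ⬝ᵥ M.mulVec v.1) := by
  have hfst : HasFDerivAt (fun w : (ι → ℝ) × ℝ => w.1) (.fst ℝ (ι → ℝ) ℝ) w := hasFDerivAt_fst
  have hlin (B : Matrix ι ι ℝ) : HasFDerivAt (fun w : (ι → ℝ) × ℝ => B.mulVec w.1)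
      (B.mulVecLin.toContinuousLinearMap.comp (.fst ℝ (ι → ℝ) ℝ)) w :=
    B.mulVecLin.toContinuousLinearMap.hasFDerivAt.comp w hfst
  rw [((hlin A).prodMk (hfst.dotProduct_real (hlin M))).fderiv]
  ext
  · simp
  · simp [dotProduct, Finset.sum_add_distrib, mul_comm, add_comm]

lemma fderiv_const_affine_apply {ι : Type*} [Fintype ι] (a c : ι → ℝ) (l : ℝ)
    (w v : (ι → ℝ) × ℝ) :
    fderiv ℝ (fun w : (ι → ℝ) × ℝ => (a, w.1 ⬝ᵥ c + l)) w v = (0, v.1 ⬝ᵥ c) := by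
  have hfst : HasFDerivAt (fun w : (ι → ℝ) × ℝ => w.1) (.fst ℝ (ι → ℝ) ℝ) w := hasFDerivAt_fst
  rw [((hasFDerivAt_const a w).prodMk
    ((hfst.dotProduct_real (hasFDerivAt_const c w)).add_const l)).fderiv]
  ext
  · simp
  · simp [dotProduct, mul_comm]

lemma dotProduct_mulVec_comm_of_transpose_eq {ι : Type*} [Fintype ι] {M : Matrix ι ι ℝ}
    (hM : Mᵀ = M) (v w : ι → ℝ) : v ⬝ᵥ M.mulVec w = w ⬝ᵥ M.mulVec v := by
  rw [← dotProduct_transpose_mulVec, hM]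

lemma lieBracket_linear_quadratic_const_affine {ι : Type*} [Fintype ι] (A M : Matrix ι ι ℝ)
    (hM : Mᵀ = M) (a c : ι → ℝ) (l : ℝ) :
    lieBracket (fun w : (ι → ℝ) × ℝ => (A.mulVec w.1, w.1 ⬝ᵥ M.mulVec w.1))
        (fun w => (a, w.1 ⬝ᵥ c + l))
      = fun w => (-A.mulVec a, w.1 ⬝ᵥ (Aᵀ.mulVec c - (2 : ℝ) • M.mulVec a) + 0) := by
  funext w
  simp only [lieBracket, fderiv_linear_quadratic_apply, fderiv_const_affine_apply, Prod.mk_sub_mk,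
    dotProduct_transpose_mulVec, dotProduct_comm c, dotProduct_mulVec_comm_of_transpose_eq hM a,
    zero_sub, dotProduct_sub, dotProduct_smul, smul_eq_mul, add_zero, two_mul]

/-- Double bracket with two control fields for the linear
port-Hamiltonian problem. -/
theorem linear_pH_double_bracket_controls
    (n m : ℕ)
    (A : Matrix (Fin n) (Fin n) ℝ)
    (Q : Matrix (Fin n) (Fin n) ℝ) (hQsym : Qᵀ = Q)
    (Y : Matrix (Fin m) (Fin m) ℝ) (hYsym : Yᵀ = Y)
    (G : Matrix (Fin n) (Fin m) ℝ) (N : Matrix (Fin m) (Fin m) ℝ)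
    (g : Fin m → Fin n → ℝ) (hg : ∀ i, g i = fun r => G r i)
    (nv : Fin m → Fin m → ℝ) (hnv : ∀ i, nv i = fun r => N r i)
    (l : Fin m → ℝ)
    (f0 : ((Fin n → ℝ) × ℝ) → ((Fin n → ℝ) × ℝ))
    (hf0 : f0 = fun w => (A.mulVec w.1, w.1 ⬝ᵥ (Q * G * Y * Gᵀ * Q).mulVec w.1))
    (f : Fin m → ((Fin n → ℝ) × ℝ) → ((Fin n → ℝ) × ℝ))
    (hf : ∀ i, f i = fun w => (g i, w.1 ⬝ᵥ (Q * G).mulVec (nv i) + l i)) :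
    ∀ i j : Fin m, ∀ w : (Fin n → ℝ) × ℝ,
      lieBracket (f j) (lieBracket f0 (f i)) w
        = (0, nv i ⬝ᵥ (Gᵀ * Q * A).mulVec (g j)
              - 2 * (g i ⬝ᵥ (Q * G * Y * Gᵀ * Q).mulVec (g j))
              + nv j ⬝ᵥ (Gᵀ * Q * A).mulVec (g i)) := by
  intro i j w
  have hM : (Q * G * Y * Gᵀ * Q)ᵀ = Q * G * Y * Gᵀ * Q := by
    simp only [transpose_mul, transpose_transpose, hQsym, hYsym, Matrix.mul_assoc]
  have hcross (k : Fin m) (v : Fin n → ℝ) :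
      nv k ⬝ᵥ (Gᵀ * Q * A).mulVec v = (Q * G).mulVec (nv k) ⬝ᵥ A.mulVec v := by
    have hT : Gᵀ * Q = (Q * G)ᵀ := by rw [transpose_mul, hQsym]
    rw [hT, ← mulVec_mulVec, dotProduct_transpose_mulVec, dotProduct_comm]
  rw [hf0, hf i, hf j, lieBracket_linear_quadratic_const_affine A _ hM]
  simp only [lieBracket, fderiv_const_affine_apply, Prod.mk_sub_mk, sub_zero, hcross,
    dotProduct_mulVec_comm_of_transpose_eq hM (g i) (g j)]
  simp only [dotProduct_sub, dotProduct_smul, smul_eq_mul, neg_dotProduct, sub_neg_eq_add,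
    dotProduct_transpose_mulVec, dotProduct_comm (A.mulVec _)]
end

section
/- Second derivative of the switching function in the case N = 0: Let u : I → ℝ^m be continuously differentiable on an open interval I, and let x, p : I → ℝ^n be differentiable with x'(t) = A x(t) + G u(t) and p'(t) = −Aᵀ p(t) − 2 Q G Y Gᵀ Q x(t) for all t ∈ I (the adjoint equation with N = 0 and Y symmetric). For i ∈ {1,…,m}, define s_i(t) := p(t)ᵀ g_i + ℓ_i. Then s_i is twice differentiable on I and for all t ∈ I: s_i''(t) = p(t)ᵀ A² g_i + 2 x(t)ᵀ Q G Y Gᵀ Q A g_i − 2 x(t)ᵀ Aᵀ Q G Y Gᵀ Q g_i − 2 u(t)ᵀ Gᵀ Q G Y Gᵀ Q g_i. -/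
open Matrix

/-- Differentiation of the dot product with a constant vector. -/
theorem HasDerivAt.dotProduct_const {ι : Type*} [Fintype ι] {f : ℝ → ι → ℝ} {f' : ι → ℝ} {t : ℝ}
    (hf : HasDerivAt f f' t) (v : ι → ℝ) :
    HasDerivAt (fun τ => f τ ⬝ᵥ v) (f' ⬝ᵥ v) t :=
  HasDerivAt.fun_sum fun j _ => (hasDerivAt_pi.1 hf j).mul_const (v j)

/-- A matrix acting on the left factor of a dot product moves to the right as its transpose. -/
theorem Matrix.mulVec_dotProduct_eq_dotProduct_transpose_mulVec {ι κ : Type*} [Fintype ι]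
    [Fintype κ] (M : Matrix ι κ ℝ) (v : κ → ℝ) (w : ι → ℝ) :
    M.mulVec v ⬝ᵥ w = v ⬝ᵥ Mᵀ.mulVec w := by
  rw [dotProduct_mulVec, vecMul_transpose]

/-- Second derivative of the switching function in the case `N = 0`. -/
theorem switching_function_second_derivative_N_zero
    (n m : ℕ)
    (A : Matrix (Fin n) (Fin n) ℝ)
    (Q : Matrix (Fin n) (Fin n) ℝ) (hQsym : Qᵀ = Q)
    (Y : Matrix (Fin m) (Fin m) ℝ) (hYsym : Yᵀ = Y)
    (G : Matrix (Fin n) (Fin m) ℝ)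
    (g : Fin m → Fin n → ℝ) (hg : ∀ i, g i = fun r => G r i)
    (l : Fin m → ℝ)
    (a b : ℝ) (u : ℝ → Fin m → ℝ) (hu : ContDiffOn ℝ 1 u (Set.Ioo a b))
    (x p : ℝ → Fin n → ℝ)
    (hx : ∀ t ∈ Set.Ioo a b, HasDerivAt x (A.mulVec (x t) + G.mulVec (u t)) t)
    (hp : ∀ t ∈ Set.Ioo a b, HasDerivAt p
      (-(Aᵀ.mulVec (p t)) - (2 : ℝ) • (Q * G * Y * Gᵀ * Q).mulVec (x t)) t) :
    ∀ i : Fin m, ∃ s' : ℝ → ℝ,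
      (∀ t ∈ Set.Ioo a b,
        HasDerivAt (fun τ => p τ ⬝ᵥ g i + l i) (s' t) t)
      ∧ (∀ t ∈ Set.Ioo a b,
          HasDerivAt s'
            (p t ⬝ᵥ (A * A).mulVec (g i)
              + 2 * (x t ⬝ᵥ (Q * G * Y * Gᵀ * Q * A).mulVec (g i))
              - 2 * (x t ⬝ᵥ (Aᵀ * Q * G * Y * Gᵀ * Q).mulVec (g i))
              - 2 * (u t ⬝ᵥ (Gᵀ * Q * G * Y * Gᵀ * Q).mulVec (g i))) t) := by
  intro i
  have hM : (Q * G * Y * Gᵀ * Q)ᵀ = Q * G * Y * Gᵀ * Q := by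
    simp only [transpose_mul, transpose_transpose, hQsym, hYsym, Matrix.mul_assoc]
  have hA : Aᵀ * Q * G * Y * Gᵀ * Q = Aᵀ * (Q * G * Y * Gᵀ * Q) := by
    simp only [Matrix.mul_assoc]
  have hG : Gᵀ * Q * G * Y * Gᵀ * Q = Gᵀ * (Q * G * Y * Gᵀ * Q) := by
    simp only [Matrix.mul_assoc]
  rw [hA, hG]
  generalize Q * G * Y * Gᵀ * Q = M at hM hp ⊢
  have hp' (t : ℝ) (ht : t ∈ Set.Ioo a b) (w : Fin n → ℝ) :
      HasDerivAt (fun τ => p τ ⬝ᵥ w)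
        (-(p t ⬝ᵥ A.mulVec w) - 2 * (x t ⬝ᵥ M.mulVec w)) t := by
    refine ((hp t ht).dotProduct_const w).congr_deriv ?_
    simp only [sub_dotProduct, neg_dotProduct, smul_dotProduct, smul_eq_mul,
      mulVec_dotProduct_eq_dotProduct_transpose_mulVec, transpose_transpose, hM]
  refine ⟨fun t => -(p t ⬝ᵥ A.mulVec (g i)) - 2 * (x t ⬝ᵥ M.mulVec (g i)),
    fun t ht => (hp' t ht (g i)).add_const (l i), fun t ht => ?_⟩
  refine ((hp' t ht (A.mulVec (g i))).fun_neg.fun_sub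
    (((hx t ht).dotProduct_const (M.mulVec (g i))).const_mul 2)).congr_deriv ?_
  simp only [add_dotProduct, mulVec_dotProduct_eq_dotProduct_transpose_mulVec, mulVec_mulVec]
  ring
end
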